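/- Assume (K1), (K2), (G1), (K3) and (K4). Let u be an optimal control for x₀ at time t₀, γ = γ^{t₀,x₀,u}, τ₀ = τ^{t₀,x₀,u}, and let p : [t₀, t₀+τ₀] → ℝ^d be any solution of the adjoint equation p′(t) = −(u(t)·p(t)) ∇k(t, γ(t)) on [t₀, t₀+τ₀]. If p(t₀) ∈ ∇⁻φ(t₀, x₀), then p(t) ∈ ∇⁻φ(t, γ(t)) for all t ∈ [t₀, t₀+τ₀). -/

import Mathlib

open MeasureTheory Filter Set Metric
open scoped Topology RealInnerProductSpace NNReal ENNReal

noncomputable section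

abbrev Evec (d : ℕ) := EuclideanSpace ℝ (Fin d)

variable {d : ℕ}

/-- An admissible control: a measurable function with values in the closed unit ball. -/
def IsControl (u : ℝ → Evec d) : Prop :=
  Measurable u ∧ ∀ t, ‖u t‖ ≤ 1

/-- `γ` is the (absolutely continuous) trajectory of the control system
`γ'(t) = k(t, γ(t)) u(t)` for a.e. `t ≥ t₀`, `γ(t₀) = x₀`, written in integral form. -/
def IsTrajectory (k : ℝ → Evec d → ℝ) (t₀ : ℝ) (x₀ : Evec d) (u γ : ℝ → Evec d) : Prop :=
  ∀ t, t₀ ≤ t → γ t = x₀ + ∫ s in t₀..t, k s (γ s) • u s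

/-- The set of nonnegative elapsed times at which a trajectory started at time `t₀`
lies on the boundary of `Ω`. -/
def exitSet (Ω : Set (Evec d)) (t₀ : ℝ) (γ : ℝ → Evec d) : Set ℝ :=
  {τ : ℝ | 0 ≤ τ ∧ γ (t₀ + τ) ∈ frontier Ω}

/-- The exit time `τ^{t₀,x₀,u}` (with junk value `sInf ∅ = 0` if the trajectory never
reaches the boundary). -/
def exitTime (Ω : Set (Evec d)) (t₀ : ℝ) (γ : ℝ → Evec d) : ℝ :=
  sInf (exitSet Ω t₀ γ)

/-- The cost `τ^{t₀,x₀,u} + g(γ^{t₀,x₀,u}_τ)`. -/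
def exitCost (Ω : Set (Evec d)) (g : Evec d → ℝ) (t₀ : ℝ) (γ : ℝ → Evec d) : ℝ :=
  exitTime Ω t₀ γ + g (γ (t₀ + exitTime Ω t₀ γ))

/-- The set of costs achievable from `(t₀, x₀)` by admissible controls whose
trajectory reaches the boundary. -/
def costSet (Ω : Set (Evec d)) (k : ℝ → Evec d → ℝ) (g : Evec d → ℝ)
    (t₀ : ℝ) (x₀ : Evec d) : Set ℝ :=
  {r | ∃ u γ, IsControl u ∧ IsTrajectory k t₀ x₀ u γ ∧ (exitSet Ω t₀ γ).Nonempty ∧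
    r = exitCost Ω g t₀ γ}

/-- The value function `φ(t, x)`. -/
def valueFun (Ω : Set (Evec d)) (k : ℝ → Evec d → ℝ) (g : Evec d → ℝ)
    (t : ℝ) (x : Evec d) : ℝ :=
  sInf (costSet Ω k g t x)

/-- `u` (with associated trajectory `γ`) is an optimal control for `x₀` at time `t₀`. -/
def IsOptimal (Ω : Set (Evec d)) (k : ℝ → Evec d → ℝ) (g : Evec d → ℝ)
    (t₀ : ℝ) (x₀ : Evec d) (u γ : ℝ → Evec d) : Prop :=
  IsControl u ∧ IsTrajectory k t₀ x₀ u γ ∧ (exitSet Ω t₀ γ).Nonempty ∧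
  IsLeast (costSet Ω k g t₀ x₀) (exitCost Ω g t₀ γ)

/-- The spatial subdifferential `∇⁻φ(t,x)`:
`p ∈ ∇⁻φ(t,x)` iff `liminf_{y→x} (φ(t,y) − φ(t,x) − p·(y−x))/|y−x| ≥ 0`. -/
def subDiffX (φ : ℝ → Evec d → ℝ) (t : ℝ) (x : Evec d) : Set (Evec d) :=
  {p | ∀ ε > (0 : ℝ), ∀ᶠ y in nhds x,
    -(ε * ‖y - x‖) ≤ φ t y - φ t x - ⟪p, y - x⟫}

/-- A preconnected set that meets `s` but not its frontier lies in the interior of `s`. -/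
lemma IsPreconnected.subset_interior_of_disjoint_frontier {X : Type*} [TopologicalSpace X]
    {s c : Set X} (hc : IsPreconnected c) (hd : Disjoint c (frontier s)) (hm : (c ∩ s).Nonempty) :
    c ⊆ interior s := by
  have key : ∀ x ∈ c, x ∈ closure s → x ∈ interior s := fun x hx hxs => by
    by_contra h
    exact hd.le_bot ⟨hx, hxs, h⟩
  refine hc.subset_left_of_subset_union isOpen_interior isClosed_closure.isOpen_compl
    (disjoint_compl_right_iff_subset.2 (interior_subset.trans subset_closure)) ?_ ?_
  · intro x hx
    by_cases h : x ∈ closure s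
    · exact Or.inl (key x hx h)
    · exact Or.inr h
  · obtain ⟨x, hx, hxs⟩ := hm
    exact ⟨x, hx, key x hx (subset_closure hxs)⟩

/-- Integral form of Grönwall's inequality. -/
lemma le_gronwallBound_of_le_integral {f : ℝ → ℝ} {δ K ε a b : ℝ} (hK : 0 ≤ K)
    (hf : ContinuousOn f (Icc a b))
    (h : ∀ r ∈ Icc a b, f r ≤ δ + ∫ s in a..r, (K * f s + ε)) :
    ∀ r ∈ Icc a b, f r ≤ gronwallBound δ K ε (r - a) := by
  intro r hr
  have hab : a ≤ b := hr.1.trans hr.2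
  have hc : ContinuousOn (fun s => K * f s + ε) (Icc a b) := by fun_prop
  have h_int : ∀ s ∈ Icc a b, IntervalIntegrable (fun s => K * f s + ε) volume a s := fun s hs =>
    (hc.mono (Icc_subset_Icc_right hs.2)).intervalIntegrable_of_Icc hs.1
  refine (h r hr).trans (le_gronwallBound_of_liminf_deriv_right_le (K := K) (ε := ε)
    (f := fun r => δ + ∫ s in a..r, (K * f s + ε)) (f' := fun s => K * f s + ε) (b := b)
    ?_ ?_ (by simp) ?_ r hr)
  · have := intervalIntegral.continuousOn_primitive_interval (μ := volume) (a := a) (b := b)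
      (f := fun s => K * f s + ε) (by rw [uIcc_of_le hab]; exact hc.integrableOn_Icc)
    rw [uIcc_of_le hab] at this
    exact continuousOn_const.add this
  · intro x hx y hy
    have hcx : ContinuousWithinAt (fun s => K * f s + ε) (Ioi x) x :=
      (hc x (Ico_subset_Icc_self hx)).mono_of_mem_nhdsWithin
        (mem_of_superset (Ioc_mem_nhdsGT hx.2)
          ((Ioc_subset_Icc_self).trans (Icc_subset_Icc_left hx.1)))
    have hd : HasDerivWithinAt (fun r => ∫ s in a..r, (K * f s + ε)) (K * f x + ε) (Ici x) x :=
      intervalIntegral.integral_hasDerivWithinAt_right (h_int x (Ico_subset_Icc_self hx))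
        (t := Ioi x)
        ⟨Ioc x b, Ioc_mem_nhdsGT hx.2, (hc.mono ((Ioc_subset_Icc_self).trans
          (Icc_subset_Icc_left hx.1))).aestronglyMeasurable measurableSet_Ioc⟩ hcx
    have := (hd.const_add δ).liminf_right_slope_le hy
    simpa only [slope_def_field, div_eq_inv_mul] using this
  · intro x hx
    have := mul_le_mul_of_nonneg_left (h x (Ico_subset_Icc_self hx)) hK
    simpa using this

section IntegralEquation

variable {E : Type*} [NormedAddCommGroup E] [NormedSpace ℝ E]

lemma continuousOn_of_eq_integral {x h : ℝ → E} {a b : ℝ} (hab : a ≤ b)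
    (h_int : IntervalIntegrable h volume a b)
    (hx : ∀ r ∈ Icc a b, x r = x a + ∫ s in a..r, h s) : ContinuousOn x (Icc a b) := by
  have := intervalIntegral.continuousOn_primitive_interval (μ := volume) (a := a) (b := b)
    (f := h) (by
      rw [uIcc_of_le hab]
      exact (intervalIntegrable_iff_integrableOn_Icc_of_le hab).1 h_int)
  rw [uIcc_of_le hab] at this
  exact (continuousOn_const.add this).congr hx

/-- The right-hand side of an integral equation with at most affine growth is automatically
integrable, provided that it is measurable whenever the solution is. -/
lemma intervalIntegrable_of_integral_equation {x h : ℝ → E} {a b C D : ℝ}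
    (hab : a ≤ b) (hC : 0 ≤ C) (hD : 0 ≤ D)
    (hx : ∀ r ∈ Icc a b, x r = x a + ∫ s in a..r, h s)
    (hbound : ∀ r ∈ Icc a b, ‖h r‖ ≤ C * ‖x r‖ + D)
    (hmeas : AEStronglyMeasurable x (volume.restrict (Icc a b)) →
      AEStronglyMeasurable h (volume.restrict (Icc a b))) :
    IntervalIntegrable h volume a b := by
  set S : Set ℝ := {r ∈ Icc a b | IntervalIntegrable h volume a r} with hS
  have hSsub : S ⊆ Icc a b := fun r hr => hr.1
  have hSdown : ∀ r ∈ S, Icc a r ⊆ S := fun r hr s hs =>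
    ⟨⟨hs.1, hs.2.trans hr.1.2⟩, hr.2.mono_set (by
      rw [uIcc_of_le hs.1, uIcc_of_le hr.1.1]; exact Icc_subset_Icc_right hs.2)⟩
  have hSmeas : MeasurableSet S := by
    have : S.OrdConnected := ⟨fun r hr s hs y hy =>
      hSdown s hs ⟨hr.1.1.trans hy.1, hy.2⟩⟩
    exact this.measurableSet
  have hcont : ∀ r ∈ S, ContinuousOn x (Icc a r) := fun r hr =>
    continuousOn_of_eq_integral hr.1.1 hr.2 fun s hs => hx s (hSsub (hSdown r hr hs))
  have hxS : ∀ r ∈ S, ‖x r‖ ≤ gronwallBound ‖x a‖ C D (b - a) := by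
    intro r hr
    refine (le_gronwallBound_of_le_integral (f := fun s => ‖x s‖) (δ := ‖x a‖) (ε := D) hC
      (hcont r hr).norm (fun s hs => ?_) r ⟨hr.1.1, le_rfl⟩).trans
        (gronwallBound_mono (norm_nonneg _) hD hC (sub_le_sub_right hr.1.2 a))
    have hsS := hSdown r hr hs
    rw [hx s hsS.1]
    refine (norm_add_le _ _).trans (add_le_add_right ?_ _)
    refine intervalIntegral.norm_integral_le_of_norm_le hs.1 (ae_of_all _ fun y hy =>
      hbound y ⟨hy.1.le, hy.2.trans hsS.1.2⟩) ?_
    refine ContinuousOn.intervalIntegrable_of_Icc hs.1 ?_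
    have := (hcont s hsS).norm
    fun_prop
  have hxS' : ∀ r ∈ Icc a b \ S, x r = x a := by
    intro r hr
    have : ¬ IntervalIntegrable h volume a r := fun hi => hr.2 ⟨hr.1, hi⟩
    rw [hx r hr.1, intervalIntegral.integral_undef this, add_zero]
  have hlip : ContinuousOn x S := by
    set M := C * gronwallBound ‖x a‖ C D (b - a) + D
    have hM : ∀ r ∈ S, ∀ s ∈ S, r ≤ s → ‖x s - x r‖ ≤ M * |s - r| := by
      intro r hr s hs hrs
      rw [hx s hs.1, hx r hr.1, add_sub_add_left_eq_sub,
        intervalIntegral.integral_interval_sub_left hs.2 hr.2]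
      refine intervalIntegral.norm_integral_le_of_norm_le_const fun y hy => ?_
      rw [uIoc_of_le hrs] at hy
      have hyS : y ∈ S := hSdown s hs ⟨hr.1.1.trans hy.1.le, hy.2⟩
      refine (hbound y hyS.1).trans ?_
      have := mul_le_mul_of_nonneg_left (hxS y hyS) hC
      simp only [M]
      linarith
    refine LipschitzOnWith.continuousOn (K := M.toNNReal) (LipschitzOnWith.of_dist_le_mul ?_)
    intro r hr s hs
    have hMM : M ≤ (M.toNNReal : ℝ) := Real.le_coe_toNNReal M
    rcases le_total r s with hrs | hrs
    · rw [dist_comm, dist_comm r, dist_eq_norm, Real.dist_eq]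
      exact (hM r hr s hs hrs).trans (by gcongr)
    · rw [dist_eq_norm, Real.dist_eq]
      exact (hM s hs r hr hrs).trans (by gcongr)
  have hxm : AEStronglyMeasurable x (volume.restrict (Icc a b)) := by
    rw [← union_sdiff_cancel hSsub, aestronglyMeasurable_union_iff]
    refine ⟨hlip.aestronglyMeasurable hSmeas, ?_⟩
    refine (aestronglyMeasurable_const (b := x a)).congr ?_
    filter_upwards [ae_restrict_mem (measurableSet_Icc.diff hSmeas)] with r hr
    exact (hxS' r hr).symm
  obtain ⟨B, hB⟩ : ∃ B, ∀ r ∈ Icc a b, ‖x r‖ ≤ B := by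
    refine ⟨max (gronwallBound ‖x a‖ C D (b - a)) ‖x a‖, fun r hr => ?_⟩
    by_cases hrS : r ∈ S
    · exact (hxS r hrS).trans (le_max_left _ _)
    · rw [hxS' r ⟨hr, hrS⟩]; exact le_max_right _ _
  rw [intervalIntegrable_iff_integrableOn_Icc_of_le hab]
  exact IntegrableOn.of_bound (C := C * B + D) measure_Icc_lt_top (hmeas hxm) (by
    filter_upwards [ae_restrict_mem measurableSet_Icc] with r hr
    refine (hbound r hr).trans ?_
    have := hB r hr
    gcongr)

/-- Backward Grönwall estimate for an indefinite integral whose integrand is controlled by the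
function itself. -/
lemma norm_le_exp_mul_norm_right {z h : ℝ → E} {a b L : ℝ} (hab : a ≤ b) (hL : 0 ≤ L)
    (h_int : IntervalIntegrable h volume a b)
    (hz : ∀ r ∈ Icc a b, z r = z a + ∫ s in a..r, h s)
    (hb : ∀ r ∈ Icc a b, ‖h r‖ ≤ L * ‖z r‖) :
    ∀ r ∈ Icc a b, ‖z r‖ ≤ Real.exp (L * (b - a)) * ‖z b‖ := by
  have hzc := continuousOn_of_eq_integral hab h_int hz
  have hmap : ∀ r ∈ Icc 0 (b - a), b - r ∈ Icc a b := fun r hr =>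
    ⟨by linarith [hr.2], by linarith [hr.1]⟩
  have key := le_gronwallBound_of_le_integral (f := fun r => ‖z (b - r)‖) (δ := ‖z b‖) (ε := 0)
    (a := 0) (b := b - a) hL
    ((hzc.comp (by fun_prop : ContinuousOn (fun r => b - r) (Icc 0 (b - a))) hmap).norm) (by
      intro r hr
      have hr' := hmap r hr
      have hi : ∀ y ∈ Icc a b, IntervalIntegrable h volume a y := fun y hy =>
        h_int.mono_set (by
          rw [uIcc_of_le hy.1, uIcc_of_le hab]; exact Icc_subset_Icc_right hy.2)
      have e : z (b - r) = z b - ∫ s in (b - r)..b, h s := by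
        rw [hz _ hr', hz b ⟨hab, le_rfl⟩, ← intervalIntegral.integral_interval_sub_left
          (hi b ⟨hab, le_rfl⟩) (hi _ hr')]
        abel
      have e2 := intervalIntegral.integral_comp_sub_left (a := 0) (b := r)
        (fun s => L * ‖z s‖ + 0) b
      rw [sub_zero] at e2
      rw [e2, e]
      refine (norm_sub_le _ _).trans (add_le_add_right ?_ _)
      refine intervalIntegral.norm_integral_le_of_norm_le hr'.2 (ae_of_all _ fun y hy => ?_) ?_
      · rw [add_zero]
        exact hb y ⟨hr'.1.trans hy.1.le, hy.2⟩
      · refine ContinuousOn.intervalIntegrable_of_Icc hr'.2 ?_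
        have := (hzc.mono (Icc_subset_Icc_left hr'.1)).norm
        fun_prop)
  intro r hr
  have h1 := key (b - r) ⟨by linarith [hr.2], by linarith [hr.1]⟩
  simp only [sub_sub_cancel, sub_zero, gronwallBound_ε0] at h1
  rw [mul_comm]
  refine h1.trans ?_
  have := hr.1
  gcongr

lemma lipschitzOnWith_of_eq_integral {x h : ℝ → E} {a b C : ℝ}
    (h_int : IntervalIntegrable h volume a b) (hC : ∀ r ∈ Icc a b, ‖h r‖ ≤ C)
    (hx : ∀ r ∈ Icc a b, x r = x a + ∫ s in a..r, h s) :
    LipschitzOnWith C.toNNReal x (Icc a b) := by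
  have key : ∀ r ∈ Icc a b, ∀ s ∈ Icc a b, r ≤ s → dist (x r) (x s) ≤ C.toNNReal * dist r s := by
    intro r hr s hs hrs
    have hab : a ≤ b := hr.1.trans hr.2
    have hi : ∀ y ∈ Icc a b, IntervalIntegrable h volume a y := fun y hy =>
      h_int.mono_set (by
        rw [uIcc_of_le hy.1, uIcc_of_le hab]; exact Icc_subset_Icc_right hy.2)
    rw [dist_comm, dist_comm r, dist_eq_norm, Real.dist_eq, hx s hs, hx r hr,
      add_sub_add_left_eq_sub, intervalIntegral.integral_interval_sub_left (hi s hs) (hi r hr)]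
    refine intervalIntegral.norm_integral_le_of_norm_le_const fun y hy => ?_
    rw [uIoc_of_le hrs] at hy
    exact (hC y ⟨hr.1.trans hy.1.le, hy.2.trans hs.2⟩).trans (Real.le_coe_toNNReal C)
  refine LipschitzOnWith.of_dist_le_mul fun r hr s hs => ?_
  rcases le_total r s with hrs | hrs
  · exact key r hr s hs hrs
  · rw [dist_comm, dist_comm r]
    exact key s hs r hr hrs

/-- The pairing of two Lipschitz indefinite integrals changes at most by the integral of the bound
on its almost everywhere derivative. -/
lemma abs_inner_sub_inner_le {V : Type*} [NormedAddCommGroup V] [InnerProductSpace ℝ V]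
    [CompleteSpace V] {P Z a b : ℝ → V} {s t A B C : ℝ}
    (hst : s ≤ t) (ha : IntervalIntegrable a volume s t) (hb : IntervalIntegrable b volume s t)
    (hA : ∀ r ∈ Icc s t, ‖a r‖ ≤ A) (hB : ∀ r ∈ Icc s t, ‖b r‖ ≤ B)
    (hP : ∀ r ∈ Icc s t, P r = P s + ∫ y in s..r, a y)
    (hZ : ∀ r ∈ Icc s t, Z r = Z s + ∫ y in s..r, b y)
    (hC : ∀ r ∈ Icc s t, |⟪P r, b r⟫ + ⟪a r, Z r⟫| ≤ C) :
    |⟪P t, Z t⟫ - ⟪P s, Z s⟫| ≤ C * (t - s) := by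
  have hPlip := lipschitzOnWith_of_eq_integral ha hA hP
  have hZlip := lipschitzOnWith_of_eq_integral hb hB hZ
  obtain ⟨M, hM⟩ := isCompact_Icc.exists_bound_of_continuousOn hPlip.continuousOn
  obtain ⟨N, hN⟩ := isCompact_Icc.exists_bound_of_continuousOn hZlip.continuousOn
  have hG : AbsolutelyContinuousOnInterval (fun r => ⟪P r, Z r⟫) s t := by
    refine LipschitzOnWith.absolutelyContinuousOnInterval
      (K := A.toNNReal * N.toNNReal + M.toNNReal * B.toNNReal) ?_
    rw [uIcc_of_le hst]
    refine LipschitzOnWith.of_dist_le_mul fun x hx y hy => ?_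
    have h1 := hPlip.dist_le_mul x hx y hy
    have h2 := hZlip.dist_le_mul x hx y hy
    rw [dist_eq_norm] at h1 h2
    have e : ⟪P x, Z x⟫ - ⟪P y, Z y⟫ = ⟪P x - P y, Z x⟫ + ⟪P y, Z x - Z y⟫ := by
      rw [inner_sub_left, inner_sub_right]; ring
    have hN' : ‖Z x‖ ≤ N.toNNReal := (hN x hx).trans (Real.le_coe_toNNReal N)
    have hM' : ‖P y‖ ≤ M.toNNReal := (hM y hy).trans (Real.le_coe_toNNReal M)
    rw [Real.dist_eq, e]
    calc |⟪P x - P y, Z x⟫ + ⟪P y, Z x - Z y⟫|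
        ≤ ‖P x - P y‖ * ‖Z x‖ + ‖P y‖ * ‖Z x - Z y‖ :=
          (abs_add_le _ _).trans
            (add_le_add (abs_real_inner_le_norm _ _) (abs_real_inner_le_norm _ _))
      _ ≤ (A.toNNReal * dist x y) * N.toNNReal + M.toNNReal * (B.toNNReal * dist x y) := by
          gcongr
      _ = _ := by push_cast; ring
  rw [← hG.integral_deriv_eq_sub, ← Real.norm_eq_abs, ← abs_of_nonneg (sub_nonneg.2 hst)]
  refine intervalIntegral.norm_integral_le_of_norm_le_const_ae ?_
  have hne : ∀ᵐ x : ℝ, x ≠ t := by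
    simp [ae_iff]
  filter_upwards [ha.ae_hasDerivAt_integral, hb.ae_hasDerivAt_integral, hne] with x hxa hxb hxt hx
  rw [uIoc_of_le hst] at hx
  have hx' : x ∈ Icc s t := Ioc_subset_Icc_self hx
  have hnhds : Icc s t ∈ 𝓝 x := Icc_mem_nhds hx.1 (lt_of_le_of_ne hx.2 hxt)
  have hs : s ∈ uIcc s t := left_mem_uIcc
  have hxu : x ∈ uIcc s t := by rwa [uIcc_of_le hst]
  have hP' : HasDerivAt P (a x) x :=
    ((hxa hxu s hs).const_add (P s)).congr_of_eventuallyEq (by filter_upwards [hnhds] using hP)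
  have hZ' : HasDerivAt Z (b x) x :=
    ((hxb hxu s hs).const_add (Z s)).congr_of_eventuallyEq (by filter_upwards [hnhds] using hZ)
  rw [(hP'.inner ℝ hZ').deriv]
  exact hC x hx'

lemma abs_integral_exp_mul_abs_le {c : ℝ} (hc : 0 < c) (a s : ℝ) :
    |∫ r in a..s, Real.exp (c * |r - a|)| ≤ Real.exp (c * |s - a|) / c := by
  rcases le_total a s with h | h
  · have e : ∫ r in a..s, Real.exp (c * |r - a|) = ∫ r in a..s, Real.exp (c * (r - a)) := by
      refine intervalIntegral.integral_congr fun r hr => ?_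
      rw [uIcc_of_le h] at hr
      simp only [abs_of_nonneg (sub_nonneg.2 hr.1)]
    have hd : ∀ r ∈ uIcc a s, HasDerivAt (fun r => Real.exp (c * (r - a)) / c)
        (Real.exp (c * (r - a))) r := fun r _ => by
      have := ((((hasDerivAt_id r).sub_const a).const_mul c).exp).div_const c
      convert! this using 1
      simp; field_simp
    rw [e, intervalIntegral.integral_eq_sub_of_hasDerivAt hd
      (Continuous.intervalIntegrable (by fun_prop) _ _), abs_of_nonneg (sub_nonneg.2 h), ← sub_div]
    have h1 : 1 ≤ Real.exp (c * (s - a)) := Real.one_le_exp (mul_nonneg hc.le (sub_nonneg.2 h))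
    rw [sub_self, mul_zero, Real.exp_zero, abs_of_nonneg (by apply div_nonneg <;> linarith)]
    gcongr
    linarith
  · have e : ∫ r in a..s, Real.exp (c * |r - a|) = ∫ r in a..s, Real.exp (-c * (r - a)) := by
      refine intervalIntegral.integral_congr fun r hr => ?_
      rw [uIcc_of_ge h] at hr
      simp only [abs_of_nonpos (sub_nonpos.2 hr.2), mul_neg, neg_mul]
    have hd : ∀ r ∈ uIcc a s, HasDerivAt (fun r => - (Real.exp (-c * (r - a)) / c))
        (Real.exp (-c * (r - a))) r := fun r _ => by
      have := (((((hasDerivAt_id r).sub_const a).const_mul (-c)).exp).div_const c).neg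
      convert! this using 1
      simp; field_simp
    rw [e, intervalIntegral.integral_eq_sub_of_hasDerivAt hd
      (Continuous.intervalIntegrable (by fun_prop) _ _), abs_of_nonpos (sub_nonpos.2 h)]
    have h0 : c * -(s - a) = -c * (s - a) := by ring
    have h1 : 1 ≤ Real.exp (-c * (s - a)) :=
      Real.one_le_exp (by rw [← h0]; exact mul_nonneg hc.le (by linarith))
    have h2 : -(Real.exp (-c * (s - a)) / c) - -(1 / c) = -((Real.exp (-c * (s - a)) - 1) / c) := by
      ring
    rw [sub_self, mul_zero, Real.exp_zero, h0, h2, abs_neg,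
      abs_of_nonneg (by apply div_nonneg <;> linarith)]
    gcongr
    linarith

/-- Global existence for a bounded ordinary differential equation, in integral form, whose
right-hand side is Lipschitz in space but only measurable in time. -/
lemma exists_eq_integral_of_lipschitz [CompleteSpace E] (F : ℝ → E → E) {L M : ℝ}
    (hmeas : ∀ w : ℝ → E, Continuous w → AEStronglyMeasurable (fun r => F r (w r)))
    (hbound : ∀ r x, ‖F r x‖ ≤ M) (hlip : ∀ r x y, ‖F r x - F r y‖ ≤ L * ‖x - y‖)
    (a : ℝ) (y : E) :
    ∃ η : ℝ → E, Continuous η ∧ ∀ s, η s = y + ∫ r in a..s, F r (η r) := by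
  set c : ℝ := 2 * (|L| + 1) with hc
  have hc0 : 0 < c := by positivity
  have hc1 : 1 ≤ c := by have := abs_nonneg L; linarith
  set W : ℝ → ℝ := fun r => Real.exp (c * |r - a|) with hW
  have hWpos : ∀ r, 0 < W r := fun r => Real.exp_pos _
  have hWcont : Continuous W := by fun_prop
  have hWinv : Continuous fun r => (W r)⁻¹ := hWcont.inv₀ fun r => (hWpos r).ne'
  have h_int : ∀ w : ℝ → E, Continuous w → ∀ s t : ℝ,
      IntervalIntegrable (fun r => F r (w r)) volume s t := fun w hw s t =>
    intervalIntegrable_iff.2 <| IntegrableOn.of_bound (C := M) measure_Ioc_lt_top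
      (hmeas w hw).restrict (ae_of_all _ fun r => hbound r _)
  have hM : 0 ≤ M := (norm_nonneg _).trans (hbound 0 0)
  have hbd : ∀ (w : ℝ → E) (s : ℝ),
      ‖(W s)⁻¹ • (y + ∫ r in a..s, F r (W r • w r))‖ ≤ ‖y‖ + M := by
    intro w s
    have h1 : ‖∫ r in a..s, F r (W r • w r)‖ ≤ M * |s - a| :=
      intervalIntegral.norm_integral_le_of_norm_le_const fun r _ => hbound r _
    have h2 : |s - a| + 1 ≤ W s :=
      (Real.add_one_le_exp _).trans
        (Real.exp_le_exp.2 (le_mul_of_one_le_left (abs_nonneg _) hc1))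
    rw [norm_smul, norm_inv, Real.norm_of_nonneg (hWpos s).le, inv_mul_le_iff₀ (hWpos s)]
    refine (norm_add_le _ _).trans ?_
    have := norm_nonneg y
    have := abs_nonneg (s - a)
    nlinarith
  let Φ : BoundedContinuousFunction ℝ E → BoundedContinuousFunction ℝ E := fun w =>
    BoundedContinuousFunction.ofNormedAddCommGroup
      (fun s => (W s)⁻¹ • (y + ∫ r in a..s, F r (W r • w r)))
      (hWinv.smul (continuous_const.add (intervalIntegral.continuous_primitive
        (h_int (fun r => W r • w r) (hWcont.smul w.continuous)) a))) (‖y‖ + M) (hbd w)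
  have hΦ : ∀ w s, Φ w s = (W s)⁻¹ • (y + ∫ r in a..s, F r (W r • w r)) := fun _ _ => rfl
  have hcontr : ContractingWith (1 / 2) Φ := by
    refine ⟨by rw [← NNReal.coe_lt_coe]; norm_num, LipschitzWith.of_dist_le_mul fun w v => ?_⟩
    rw [BoundedContinuousFunction.dist_le (by positivity)]
    intro s
    have hwv : ∀ r, ‖w r - v r‖ ≤ dist w v := fun r => by
      rw [← dist_eq_norm]; exact BoundedContinuousFunction.dist_coe_le_dist r
    have h1 : ‖(∫ r in a..s, F r (W r • w r)) - ∫ r in a..s, F r (W r • v r)‖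
        ≤ |∫ r in a..s, (|L| * dist w v) * W r| := by
      rw [← intervalIntegral.integral_sub
        (h_int (fun r => W r • w r) (hWcont.smul w.continuous) _ _)
        (h_int (fun r => W r • v r) (hWcont.smul v.continuous) _ _)]
      refine intervalIntegral.norm_integral_le_abs_of_norm_le (ae_of_all _ fun r => ?_)
        (Continuous.intervalIntegrable (by fun_prop) _ _)
      refine (hlip r _ _).trans ?_
      rw [← smul_sub, norm_smul, Real.norm_of_nonneg (hWpos r).le]
      calc L * (W r * ‖w r - v r‖) ≤ |L| * (W r * dist w v) := by
            gcongr
            · exact le_abs_self L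
            · exact hwv r
        _ = _ := by ring
    rw [intervalIntegral.integral_const_mul, abs_mul, abs_of_nonneg (by positivity)] at h1
    have h2 := abs_integral_exp_mul_abs_le hc0 a s
    rw [dist_eq_norm, hΦ, hΦ, ← smul_sub, add_sub_add_left_eq_sub, norm_smul, norm_inv,
      Real.norm_of_nonneg (hWpos s).le, inv_mul_le_iff₀ (hWpos s)]
    have h3 : |L| * dist w v * |∫ r in a..s, W r| ≤ |L| * dist w v * (W s / c) :=
      mul_le_mul_of_nonneg_left h2 (by positivity)
    refine (h1.trans h3).trans ?_
    have h4 : |L| / c ≤ 1 / 2 := by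
      rw [div_le_div_iff₀ hc0 two_pos]; linarith
    calc |L| * dist w v * (W s / c) = (|L| / c) * (W s * dist w v) := by ring
      _ ≤ (1 / 2) * (W s * dist w v) := by
          have := hWpos s
          gcongr
      _ = _ := by push_cast; ring
  have hfix := hcontr.fixedPoint_isFixedPt
  set w := ContractingWith.fixedPoint Φ hcontr
  refine ⟨fun s => W s • w s, hWcont.smul w.continuous, fun s => ?_⟩
  have : w s = (W s)⁻¹ • (y + ∫ r in a..s, F r (W r • w r)) := by
    conv_lhs => rw [← hfix.eq]
    exact hΦ w s
  change W s • w s = _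
  rw [this, smul_smul, mul_inv_cancel₀ (hWpos s).ne', one_smul]

end IntegralEquation

section Trajectory

variable {k : ℝ → Evec d → ℝ} {kmin kmax : ℝ} {Ω : Set (Evec d)} {g : Evec d → ℝ}

lemma continuous_dynamic_max_zero
    (hkcont : ContinuousOn (fun p : ℝ × Evec d => k p.1 p.2) (Set.Ici 0 ×ˢ Set.univ)) :
    Continuous (Function.uncurry fun s x => k (max s 0) x) :=
  hkcont.comp_continuous (f := fun q : ℝ × Evec d => (max q.1 0, q.2)) (by fun_prop)
    fun q => ⟨le_max_right q.1 0, mem_univ _⟩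

lemma aestronglyMeasurable_dynamic_smul
    (hkcont : ContinuousOn (fun p : ℝ × Evec d => k p.1 p.2) (Set.Ici 0 ×ˢ Set.univ))
    {u x : ℝ → Evec d} (hu : Measurable u) {a b : ℝ} (ha : 0 ≤ a)
    (hx : AEStronglyMeasurable x (volume.restrict (Icc a b))) :
    AEStronglyMeasurable (fun s => k s (x s) • u s) (volume.restrict (Icc a b)) := by
  have h1 : AEStronglyMeasurable (fun s => k (max s 0) (x s)) (volume.restrict (Icc a b)) :=
    (continuous_dynamic_max_zero hkcont).comp_aestronglyMeasurable₂
      aestronglyMeasurable_id hx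
  refine (h1.smul hu.aestronglyMeasurable).congr ?_
  filter_upwards [ae_restrict_mem measurableSet_Icc] with s hs
  simp [max_eq_left (ha.trans hs.1)]

lemma norm_dynamic_smul_le
    (hkpos : ∀ t x, 0 ≤ t → 0 ≤ k t x) (hkmax : ∀ t x, 0 ≤ t → k t x ≤ kmax)
    {u : ℝ → Evec d} (hu : IsControl u) {s : ℝ} (hs : 0 ≤ s) (x : Evec d) :
    ‖k s x • u s‖ ≤ kmax := by
  rw [norm_smul, Real.norm_of_nonneg (hkpos s x hs)]
  exact (mul_le_of_le_one_right (hkpos s x hs) (hu.2 s)).trans (hkmax s x hs)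

lemma IsTrajectory.apply_start {t₀ : ℝ} {x₀ : Evec d} {u γ : ℝ → Evec d}
    (h : IsTrajectory k t₀ x₀ u γ) : γ t₀ = x₀ := by
  simpa using h t₀ le_rfl

lemma IsTrajectory.intervalIntegrable
    (hkcont : ContinuousOn (fun p : ℝ × Evec d => k p.1 p.2) (Set.Ici 0 ×ˢ Set.univ))
    (hkpos : ∀ t x, 0 ≤ t → 0 ≤ k t x) (hkmax : ∀ t x, 0 ≤ t → k t x ≤ kmax)
    {t₀ : ℝ} (ht₀ : 0 ≤ t₀) {x₀ : Evec d} {u γ : ℝ → Evec d} (hu : IsControl u)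
    (h : IsTrajectory k t₀ x₀ u γ) {t : ℝ} (ht : t₀ ≤ t) :
    IntervalIntegrable (fun s => k s (γ s) • u s) volume t₀ t := by
  refine intervalIntegrable_of_integral_equation (x := γ) (C := 0) (D := kmax) ht le_rfl
    ((hkpos t₀ x₀ ht₀).trans (hkmax t₀ x₀ ht₀)) (fun r hr => ?_) (fun r hr => ?_)
    (aestronglyMeasurable_dynamic_smul hkcont hu.1 ht₀)
  · rw [h.apply_start]; exact h r hr.1
  · rw [zero_mul, zero_add]
    exact norm_dynamic_smul_le hkpos hkmax hu (ht₀.trans hr.1) _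

lemma IsTrajectory.continuousOn
    (hkcont : ContinuousOn (fun p : ℝ × Evec d => k p.1 p.2) (Set.Ici 0 ×ˢ Set.univ))
    (hkpos : ∀ t x, 0 ≤ t → 0 ≤ k t x) (hkmax : ∀ t x, 0 ≤ t → k t x ≤ kmax)
    {t₀ : ℝ} (ht₀ : 0 ≤ t₀) {x₀ : Evec d} {u γ : ℝ → Evec d} (hu : IsControl u)
    (h : IsTrajectory k t₀ x₀ u γ) : ContinuousOn γ (Ici t₀) := by
  intro t ht
  have hc : ContinuousOn γ (Icc t₀ (t + 1)) :=
    continuousOn_of_eq_integral (by linarith [mem_Ici.1 ht])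
      (h.intervalIntegrable hkcont hkpos hkmax ht₀ hu (by linarith [mem_Ici.1 ht]))
      fun r hr => by rw [h.apply_start]; exact h r hr.1
  refine (hc t ⟨ht, by linarith⟩).mono_of_mem_nhdsWithin ?_
  rw [← Ici_inter_Iic]
  exact inter_mem_nhdsWithin _ (Iic_mem_nhds (by linarith))

/-- A trajectory that starts in `Ω` and does not meet the frontier stays in the interior. -/
lemma mem_interior_of_forall_notMem_frontier {γ : ℝ → Evec d} {a b : ℝ}
    (hab : a ≤ b) (hγ : ContinuousOn γ (Icc a b)) (ha : γ a ∈ Ω)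
    (hf : ∀ r ∈ Icc a b, γ r ∉ frontier Ω) : ∀ r ∈ Icc a b, γ r ∈ interior Ω := by
  have := (isPreconnected_Icc.image γ hγ).subset_interior_of_disjoint_frontier (s := Ω)
    (disjoint_left.2 (by rintro _ ⟨r, hr, rfl⟩; exact hf r hr))
    ⟨γ a, mem_image_of_mem γ ⟨le_rfl, hab⟩, ha⟩
  exact fun r hr => this (mem_image_of_mem γ hr)

lemma isLeast_exitTime {t₀ : ℝ} {γ : ℝ → Evec d} (hγ : ContinuousOn γ (Ici t₀))
    (hne : (exitSet Ω t₀ γ).Nonempty) : IsLeast (exitSet Ω t₀ γ) (exitTime Ω t₀ γ) := by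
  have hbdd : BddBelow (exitSet Ω t₀ γ) := ⟨0, fun _ h => h.1⟩
  refine ⟨IsClosed.csInf_mem ?_ hne hbdd, fun _ h => csInf_le hbdd h⟩
  have : exitSet Ω t₀ γ = Ici 0 ∩ (fun τ => γ (t₀ + τ)) ⁻¹' frontier Ω := rfl
  rw [this]
  refine ContinuousOn.preimage_isClosed_of_isClosed ?_ isClosed_Ici isClosed_frontier
  exact hγ.comp (by fun_prop) fun τ hτ => mem_Ici.2 (le_add_of_nonneg_right hτ)

lemma bddBelow_costSet
    (hkcont : ContinuousOn (fun p : ℝ × Evec d => k p.1 p.2) (Set.Ici 0 ×ˢ Set.univ))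
    (hkpos : ∀ t x, 0 ≤ t → 0 ≤ k t x) (hkmax : ∀ t x, 0 ≤ t → k t x ≤ kmax)
    (hg0 : ∀ x ∈ frontier Ω, 0 ≤ g x) {t : ℝ} (ht : 0 ≤ t) (x : Evec d) :
    BddBelow (costSet Ω k g t x) := by
  refine ⟨0, ?_⟩
  rintro _ ⟨u, γ, hu, hγ, hne, rfl⟩
  have := (isLeast_exitTime (hγ.continuousOn hkcont hkpos hkmax ht hu) hne).1
  exact add_nonneg this.1 (hg0 _ this.2)

lemma exists_eq_integral_dynamic_smul
    (hkcont : ContinuousOn (fun p : ℝ × Evec d => k p.1 p.2) (Set.Ici 0 ×ˢ Set.univ))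
    (hkpos : ∀ t x, 0 ≤ t → 0 ≤ k t x) (hkmax : ∀ t x, 0 ≤ t → k t x ≤ kmax) {L : ℝ}
    (hklip : ∀ t, 0 ≤ t → ∀ x₁ x₂ : Evec d, |k t x₁ - k t x₂| ≤ L * ‖x₁ - x₂‖)
    {u : ℝ → Evec d} (hu : IsControl u) {t : ℝ} (ht : 0 ≤ t) (y : Evec d) :
    ∃ η : ℝ → Evec d, Continuous η ∧ ∀ s, 0 ≤ s → η s = y + ∫ r in t..s, k r (η r) • u r := by
  obtain ⟨η, hη, h⟩ := exists_eq_integral_of_lipschitz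
    (fun r x => k (max r 0) x • u r) (L := L) (M := kmax)
    (fun w hw => ((continuous_dynamic_max_zero hkcont).comp_aestronglyMeasurable₂
      aestronglyMeasurable_id hw.aestronglyMeasurable).smul hu.1.aestronglyMeasurable)
    (fun r x => by
      have h0 : (0 : ℝ) ≤ max r 0 := le_max_right _ _
      rw [norm_smul, Real.norm_of_nonneg (hkpos _ x h0)]
      exact (mul_le_of_le_one_right (hkpos _ x h0) (hu.2 r)).trans (hkmax _ x h0))
    (fun r x z => by
      rw [← sub_smul, norm_smul, Real.norm_eq_abs]
      exact (mul_le_of_le_one_right (abs_nonneg _) (hu.2 r)).trans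
        (hklip _ (le_max_right _ _) x z)) t y
  refine ⟨η, hη, fun s hs => ?_⟩
  rw [h s]
  congr 1
  refine intervalIntegral.integral_congr fun r hr => ?_
  have : 0 ≤ r := (le_min ht hs).trans hr.1
  simp [max_eq_left this]

lemma costSet_nonempty (hΩ : IsCompact Ω) (hfr : (frontier Ω).Nonempty)
    (hkcont : ContinuousOn (fun p : ℝ × Evec d => k p.1 p.2) (Set.Ici 0 ×ˢ Set.univ))
    (hkmin : 0 < kmin) (hkbdd : ∀ t x, 0 ≤ t → kmin ≤ k t x ∧ k t x ≤ kmax) {L : ℝ}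
    (hklip : ∀ t, 0 ≤ t → ∀ x₁ x₂ : Evec d, |k t x₁ - k t x₂| ≤ L * ‖x₁ - x₂‖)
    {t : ℝ} (ht : 0 ≤ t) {y : Evec d} (hy : y ∈ Ω) : (costSet Ω k g t y).Nonempty := by
  have hkpos : ∀ t x, 0 ≤ t → 0 ≤ k t x := fun t x h => hkmin.le.trans (hkbdd t x h).1
  have : Nontrivial (Evec d) := by
    by_contra hn
    rw [not_nontrivial_iff_subsingleton] at hn
    obtain ⟨x, hx⟩ := hfr
    have : Ω = univ := Subsingleton.eq_univ_of_nonempty ⟨y, hy⟩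
    simp [this] at hx
  obtain ⟨e, he⟩ := exists_norm_eq (Evec d) zero_le_one
  have hu : IsControl fun _ : ℝ => e := ⟨measurable_const, fun _ => he.le⟩
  obtain ⟨η, hη, h⟩ := exists_eq_integral_dynamic_smul hkcont hkpos
    (fun t x h => (hkbdd t x h).2) hklip hu ht y
  refine ⟨_, fun _ => e, η, hu, fun s hs => h s (ht.trans hs), ?_, rfl⟩
  by_contra hne
  obtain ⟨R, hR⟩ := hΩ.isBounded.exists_norm_le
  have hR0 : ‖y‖ ≤ R := hR y hy
  set T := (R + ‖y‖ + 1) / kmin with hT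
  have hT0 : 0 ≤ T := div_nonneg (by linarith [norm_nonneg y]) hkmin.le
  have hmem := mem_interior_of_forall_notMem_frontier (Ω := Ω) (γ := η) (a := t) (b := t + T)
    (by linarith) hη.continuousOn (by rw [h t ht]; simpa using hy)
    (fun r hr hfr => hne ⟨r - t, by linarith [hr.1], by simpa using hfr⟩) (t + T)
    ⟨by linarith, le_rfl⟩
  have h1 := hR _ (interior_subset hmem)
  have hkη : ContinuousOn (fun r => k r (η r)) (Icc t (t + T)) :=
    hkcont.comp (f := fun r => (r, η r)) (by fun_prop)
      fun r hr => ⟨ht.trans hr.1, mem_univ _⟩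
  have h2 : kmin * T ≤ ∫ r in t..(t + T), k r (η r) := by
    have := intervalIntegral.integral_mono_on (a := t) (b := t + T) (by linarith)
      (f := fun _ => kmin) (g := fun r => k r (η r)) (intervalIntegrable_const (μ := volume))
      (hkη.intervalIntegrable_of_Icc (by linarith))
      fun r hr => (hkbdd r _ (ht.trans hr.1)).1
    simpa [mul_comm] using this
  rw [h _ (by linarith), intervalIntegral.integral_smul_const] at h1
  have h3 : ‖(∫ r in t..(t + T), k r (η r)) • e‖ ≤ R + ‖y‖ := by
    have := norm_sub_le (y + (∫ r in t..(t + T), k r (η r)) • e) y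
    rw [add_sub_cancel_left] at this
    linarith
  rw [norm_smul, he, mul_one, Real.norm_eq_abs] at h3
  have h4 : kmin * T = R + ‖y‖ + 1 := by rw [hT]; field_simp
  linarith [le_abs_self (∫ r in t..(t + T), k r (η r))]

/-- Following a trajectory that avoids the frontier and then an admissible trajectory of finite
exit time gives an admissible trajectory whose cost is increased by the elapsed time. -/
lemma add_mem_costSet
    (hkcont : ContinuousOn (fun p : ℝ × Evec d => k p.1 p.2) (Set.Ici 0 ×ˢ Set.univ))
    (hkpos : ∀ t x, 0 ≤ t → 0 ≤ k t x) (hkmax : ∀ t x, 0 ≤ t → k t x ≤ kmax)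
    {t₀ t : ℝ} (ht₀ : 0 ≤ t₀) (htt : t₀ ≤ t) {x : Evec d} {u η : ℝ → Evec d} (hu : IsControl u)
    (h_int : IntervalIntegrable (fun s => k s (η s) • u s) volume t₀ t)
    (hη : ∀ s ∈ Icc t₀ t, η s = x + ∫ r in t₀..s, k r (η r) • u r)
    (hf : ∀ s ∈ Ico t₀ t, η s ∉ frontier Ω) {c : ℝ} (hc : c ∈ costSet Ω k g t (η t)) :
    (t - t₀) + c ∈ costSet Ω k g t₀ x := by
  obtain ⟨v, ζ, hv, hζ, hne, rfl⟩ := hc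
  have hζleast := isLeast_exitTime (hζ.continuousOn hkcont hkpos hkmax (ht₀.trans htt) hv) hne
  set w : ℝ → Evec d := fun s => if s < t then u s else v s with hw
  set ξ : ℝ → Evec d := fun s => if s < t then η s else ζ s with hξ
  have hξ1 : ∀ s, s < t → ξ s = η s := fun s hs => if_pos hs
  have hξ2 : ∀ s, t ≤ s → ξ s = ζ s := fun s hs => if_neg hs.not_gt
  have hleast : IsLeast (exitSet Ω t₀ ξ) ((t - t₀) + exitTime Ω t ζ) := by
    refine ⟨⟨add_nonneg (sub_nonneg.2 htt) hζleast.1.1, ?_⟩, fun τ hτ => ?_⟩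
    · rw [hξ2 _ (by linarith [hζleast.1.1])]
      convert hζleast.1.2 using 2
      ring
    · rcases lt_or_ge (t₀ + τ) t with hlt | hge
      · have := hτ.2
        rw [hξ1 _ hlt] at this
        exact absurd this (hf _ ⟨by linarith [hτ.1], hlt⟩)
      · have := hζleast.2 (show t₀ + τ - t ∈ exitSet Ω t ζ from ⟨sub_nonneg.2 hge, by
          have := hτ.2
          rw [hξ2 _ hge] at this
          simpa using this⟩)
        linarith
  have htime : exitTime Ω t₀ ξ = (t - t₀) + exitTime Ω t ζ := hleast.csInf_eq
  have hcongr1 : ∀ s ≤ t, ∀ r ∈ Ioo t₀ s, k r (ξ r) • w r = k r (η r) • u r := fun s hs r hr => by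
    have : r < t := hr.2.trans_le hs
    simp [hξ, hw, this]
  refine ⟨w, ξ, ⟨Measurable.ite measurableSet_Iio hu.1 hv.1, fun s => ?_⟩, fun s hs => ?_,
    ⟨_, hleast.1⟩, ?_⟩
  · simp only [hw]; split_ifs; exacts [hu.2 s, hv.2 s]
  · have hleft : ∀ s ∈ Icc t₀ t,
        ∫ r in t₀..s, k r (ξ r) • w r = ∫ r in t₀..s, k r (η r) • u r := fun s hs =>
      intervalIntegral.integral_congr_Ioo_of_le hs.1 (hcongr1 s hs.2)
    rcases lt_or_ge s t with hst | hst
    · rw [hξ1 s hst, hη s ⟨hs, hst.le⟩, hleft s ⟨hs, hst.le⟩]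
    · have hright : ∀ r ∈ uIcc t s, k r (ξ r) • w r = k r (ζ r) • v r := fun r hr => by
        rw [uIcc_of_le hst] at hr
        simp [hξ, hw, hr.1.not_gt]
      have hi1 : IntervalIntegrable (fun r => k r (ξ r) • w r) volume t₀ t :=
        h_int.congr_uIoo fun r hr => (hcongr1 t le_rfl r (by rwa [uIoo_of_le htt] at hr)).symm
      have hi2 : IntervalIntegrable (fun r => k r (ξ r) • w r) volume t s :=
        (hζ.intervalIntegrable hkcont hkpos hkmax (ht₀.trans htt) hv hst).congr
          fun r hr => (hright r (uIoc_subset_uIcc hr)).symm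
      rw [hξ2 s hst, hζ s hst, ← intervalIntegral.integral_add_adjacent_intervals hi1 hi2,
        hleft t ⟨htt, le_rfl⟩, intervalIntegral.integral_congr hright, hη t ⟨htt, le_rfl⟩,
        add_assoc]
  · rw [exitCost, exitCost, htime, hξ2 _ (by linarith [hζleast.1.1]), add_assoc]
    congr 4
    ring

/-- The remaining part of an admissible trajectory of finite exit time is admissible. -/
lemma exitCost_sub_mem_costSet
    (hkcont : ContinuousOn (fun p : ℝ × Evec d => k p.1 p.2) (Set.Ici 0 ×ˢ Set.univ))
    (hkpos : ∀ t x, 0 ≤ t → 0 ≤ k t x) (hkmax : ∀ t x, 0 ≤ t → k t x ≤ kmax)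
    {t₀ t : ℝ} (ht₀ : 0 ≤ t₀) {x : Evec d} {u γ : ℝ → Evec d} (hu : IsControl u)
    (hγ : IsTrajectory k t₀ x u γ) (hne : (exitSet Ω t₀ γ).Nonempty)
    (ht : t ∈ Icc t₀ (t₀ + exitTime Ω t₀ γ)) :
    exitCost Ω g t₀ γ - (t - t₀) ∈ costSet Ω k g t (γ t) := by
  have hmem := isLeast_exitTime (hγ.continuousOn hkcont hkpos hkmax ht₀ hu) hne
  have hleast : IsLeast (exitSet Ω t γ) (exitTime Ω t₀ γ - (t - t₀)) := by
    refine ⟨⟨by linarith [ht.2], ?_⟩, fun τ hτ => ?_⟩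
    · convert hmem.1.2 using 2
      ring
    · have := hmem.2 (show t - t₀ + τ ∈ exitSet Ω t₀ γ from ⟨add_nonneg (sub_nonneg.2 ht.1) hτ.1, by
        convert hτ.2 using 2
        ring⟩)
      linarith
  have htime : exitTime Ω t γ = exitTime Ω t₀ γ - (t - t₀) := hleast.csInf_eq
  refine ⟨u, γ, hu, fun s hs => ?_, ⟨_, hleast.1⟩, ?_⟩
  · have hi := fun {s} => hγ.intervalIntegrable hkcont hkpos hkmax ht₀ hu (t := s)
    rw [hγ s (ht.1.trans hs), hγ t ht.1, ← intervalIntegral.integral_interval_sub_left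
      (hi (ht.1.trans hs)) (hi ht.1)]
    abel
  · rw [exitCost, exitCost, htime, show t + (exitTime Ω t₀ γ - (t - t₀)) = t₀ + exitTime Ω t₀ γ by
      ring]
    ring

end Trajectory

/-- Quadratic bound for the first order Taylor expansion of a function whose gradient is
Lipschitz. -/
lemma abs_sub_sub_inner_gradient_le {V : Type*} [NormedAddCommGroup V] [InnerProductSpace ℝ V]
    [CompleteSpace V] {f : V → ℝ} {f' : V → V} {x y : V} {C : ℝ} (hC : 0 ≤ C)
    (hf : ∀ z ∈ closedBall x ‖y - x‖, HasGradientAt f (f' z) z)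
    (hf' : ∀ z ∈ closedBall x ‖y - x‖, ‖f' z - f' x‖ ≤ C * ‖z - x‖) :
    |f y - f x - ⟪f' x, y - x⟫| ≤ C * ‖y - x‖ ^ 2 := by
  have := Convex.norm_image_sub_le_of_norm_hasFDerivWithin_le' (𝕜 := ℝ)
    (f := f) (f' := fun z => InnerProductSpace.toDual ℝ V (f' z))
    (φ := InnerProductSpace.toDual ℝ V (f' x)) (C := C * ‖y - x‖) (x := x) (y := y)
    (fun z hz => (hf z hz).hasFDerivAt.hasFDerivWithinAt)
    (fun z hz => by
      rw [← map_sub, LinearIsometryEquiv.norm_map]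
      refine (hf' z hz).trans ?_
      rw [mem_closedBall, dist_eq_norm] at hz
      gcongr)
    (convex_closedBall x ‖y - x‖) (mem_closedBall_self (norm_nonneg _))
    (by rw [mem_closedBall, dist_eq_norm])
  rw [InnerProductSpace.toDual_apply_apply, Real.norm_eq_abs] at this
  linarith

lemma norm_gradient_le_of_abs_sub_le {V : Type*} [NormedAddCommGroup V] [InnerProductSpace ℝ V]
    [CompleteSpace V] {f : V → ℝ} {v x : V} {L : ℝ} (hL : 0 ≤ L) (hf : HasGradientAt f v x)
    (hlip : ∀ y z, |f y - f z| ≤ L * ‖y - z‖) : ‖v‖ ≤ L := by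
  rw [← (InnerProductSpace.toDual ℝ V).norm_map v]
  exact hf.hasFDerivAt.le_of_lip' hL (Eventually.of_forall fun y => hlip y x)

/-- Propagation of the spatial subdifferential along optimal trajectories:
any solution of the adjoint equation `p'(t) = −(u(t)·p(t)) ∇k(t, γ(t))` starting in the
subdifferential stays in the subdifferential. -/
theorem propagation_of_subdifferential
    (Ω : Set (Evec d)) (hΩcomp : IsCompact Ω) (hΩreg : Ω = closure (interior Ω))
    (hΩne : (interior Ω).Nonempty)
    (k : ℝ → Evec d → ℝ) (kmin kmax L₁ L₂ : ℝ)
    (hkcont : ContinuousOn (fun p : ℝ × Evec d => k p.1 p.2) (Set.Ici 0 ×ˢ Set.univ))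
    (hkmin : 0 < kmin)
    (hkbdd : ∀ t x, 0 ≤ t → kmin ≤ k t x ∧ k t x ≤ kmax)
    (hklip : ∀ t, 0 ≤ t → ∀ x₁ x₂ : Evec d, |k t x₁ - k t x₂| ≤ L₁ * ‖x₁ - x₂‖)
    (gradk : ℝ → Evec d → Evec d)
    (hkgrad : ∀ t, 0 ≤ t → ∀ x ∈ Ω, HasGradientAt (fun y => k t y) (gradk t x) x)
    (hkgradcont : ContinuousOn (fun q : ℝ × Evec d => gradk q.1 q.2) (Set.Ici 0 ×ˢ Ω))
    (hkgradlip : ∀ t, 0 ≤ t → ∀ x₀ ∈ Ω, ∀ x₁ ∈ Ω,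
      ‖gradk t x₀ - gradk t x₁‖ ≤ L₂ * ‖x₀ - x₁‖)
    (g : Evec d → ℝ) (hgcont : ContinuousOn g (frontier Ω))
    (hg0 : ∀ x ∈ frontier Ω, 0 ≤ g x)
    (lam : ℝ) (hlam : 0 < lam) (hlamk : lam < 1 / kmax)
    (hglip : ∀ x ∈ frontier Ω, ∀ y ∈ frontier Ω, |g x - g y| ≤ lam * ‖x - y‖)
    (t₀ : ℝ) (ht₀ : 0 ≤ t₀) (x₀ : Evec d) (hx₀ : x₀ ∈ Ω)
    (u γ : ℝ → Evec d) (hopt : IsOptimal Ω k g t₀ x₀ u γ)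
    (p : ℝ → Evec d)
    (hadj : ∀ t ∈ Set.Icc t₀ (t₀ + exitTime Ω t₀ γ),
      p t = p t₀ - ∫ s in t₀..t, ⟪u s, p s⟫ • gradk s (γ s))
    (hp0 : p t₀ ∈ subDiffX (valueFun Ω k g) t₀ x₀) :
    ∀ t ∈ Set.Ico t₀ (t₀ + exitTime Ω t₀ γ),
      p t ∈ subDiffX (valueFun Ω k g) t (γ t) := by
  intro t ht
  obtain ⟨hu, hγ, hne, hleast⟩ := hopt
  have hkpos : ∀ t x, 0 ≤ t → 0 ≤ k t x := fun t x h => hkmin.le.trans (hkbdd t x h).1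
  have hkmax : ∀ t x, 0 ≤ t → k t x ≤ kmax := fun t x h => (hkbdd t x h).2
  set L := |L₁| with hL
  have hL0 : 0 ≤ L := abs_nonneg _
  have hklip' : ∀ t, 0 ≤ t → ∀ x₁ x₂ : Evec d, |k t x₁ - k t x₂| ≤ L * ‖x₁ - x₂‖ :=
    fun t ht x₁ x₂ => (hklip t ht x₁ x₂).trans
      (mul_le_mul_of_nonneg_right (le_abs_self _) (norm_nonneg _))
  have htt : t₀ ≤ t := ht.1
  have ht0 : 0 ≤ t := ht₀.trans htt
  have hγcont : ContinuousOn γ (Ici t₀) := hγ.continuousOn hkcont hkpos hkmax ht₀ hu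
  have hγcont' : ContinuousOn γ (Icc t₀ t) := hγcont.mono Icc_subset_Ici_self
  have hexit := isLeast_exitTime hγcont hne
  have hγint : ∀ r ∈ Icc t₀ t, γ r ∈ interior Ω := by
    refine mem_interior_of_forall_notMem_frontier htt hγcont' (by rwa [hγ.apply_start])
      fun r hr hfr => ?_
    have := hexit.2 (show r - t₀ ∈ exitSet Ω t₀ γ from
      ⟨sub_nonneg.2 hr.1, by simpa using hfr⟩)
    linarith [hr.2, ht.2]
  have hγΩ : ∀ r ∈ Icc t₀ t, γ r ∈ Ω := fun r hr => interior_subset (hγint r hr)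
  -- the adjoint arc
  have hgradle : ∀ r ∈ Icc t₀ t, ‖gradk r (γ r)‖ ≤ L := fun r hr =>
    norm_gradient_le_of_abs_sub_le hL0 (hkgrad r (ht₀.trans hr.1) _ (hγΩ r hr))
      (hklip' r (ht₀.trans hr.1))
  have hgradcont : ContinuousOn (fun r => gradk r (γ r)) (Icc t₀ t) :=
    hkgradcont.comp (f := fun r => (r, γ r)) (continuousOn_id.prodMk hγcont')
      fun r hr => ⟨ht₀.trans hr.1, hγΩ r hr⟩
  have hpeq : ∀ r ∈ Icc t₀ t, p r = p t₀ + ∫ s in t₀..r, -(⟪u s, p s⟫ • gradk s (γ s)) := by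
    intro r hr
    rw [intervalIntegral.integral_neg, ← sub_eq_add_neg]
    exact hadj r ⟨hr.1, hr.2.trans ht.2.le⟩
  have hup : ∀ r, |⟪u r, p r⟫| ≤ ‖p r‖ := fun r =>
    (abs_real_inner_le_norm _ _).trans (mul_le_of_le_one_left (norm_nonneg _) (hu.2 r))
  have hpbound : ∀ r ∈ Icc t₀ t, ‖-(⟪u r, p r⟫ • gradk r (γ r))‖ ≤ L * ‖p r‖ := by
    intro r hr
    rw [norm_neg, norm_smul, Real.norm_eq_abs, mul_comm]
    exact mul_le_mul (hgradle r hr) (hup r) (abs_nonneg _) hL0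
  have hpint : IntervalIntegrable (fun s => -(⟪u s, p s⟫ • gradk s (γ s))) volume t₀ t :=
    intervalIntegrable_of_integral_equation (x := p) (D := 0) htt hL0 le_rfl hpeq
      (fun r hr => by rw [add_zero]; exact hpbound r hr)
      fun hm => by
        have hgm := hgradcont.aestronglyMeasurable (μ := volume) measurableSet_Icc
        have hum : AEStronglyMeasurable u (volume.restrict (Icc t₀ t)) :=
          hu.1.aestronglyMeasurable
        have hip : AEStronglyMeasurable (fun s => ⟪u s, p s⟫) (volume.restrict (Icc t₀ t)) :=
          hum.inner hm
        exact (hip.smul hgm).neg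
  obtain ⟨N, hN⟩ := isCompact_Icc.exists_bound_of_continuousOn
    (continuousOn_of_eq_integral htt hpint hpeq)
  have hN0 : 0 ≤ N := (norm_nonneg _).trans (hN t₀ ⟨le_rfl, htt⟩)
  -- a tube around the optimal trajectory
  obtain ⟨δ, hδ, hδsub⟩ := (isCompact_Icc.image_of_continuousOn hγcont').exists_thickening_subset_open
    isOpen_interior (image_subset_iff.2 hγint)
  have htube : ∀ r ∈ Icc t₀ t, ∀ z, ‖z - γ r‖ < δ → z ∈ interior Ω := fun r hr z hz =>
    hδsub (mem_thickening_iff.2 ⟨γ r, mem_image_of_mem γ hr, by rwa [dist_eq_norm]⟩)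
  set M := |L₂| with hM
  have hM0 : 0 ≤ M := abs_nonneg _
  set c := Real.exp (L * (t - t₀)) with hc
  have hc0 : 0 < c := Real.exp_pos _
  set C := N * (M * c ^ 2) * (t - t₀) with hC
  have hC0 : 0 ≤ C := mul_nonneg (by positivity) (sub_nonneg.2 htt)
  intro ε hε
  obtain ⟨ρ, hρ, hρball⟩ := Metric.eventually_nhds_iff.1 (hp0 (ε / (2 * c)) (by positivity))
  have hnear : ∀ a : ℝ, 0 < a → ∀ᶠ y in 𝓝 (γ t), ‖y - γ t‖ < a := fun a ha => by
    filter_upwards [Metric.ball_mem_nhds (γ t) ha] with y hy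
    rwa [mem_ball, dist_eq_norm] at hy
  filter_upwards [hnear (δ / c) (by positivity), hnear (ρ / c) (by positivity),
    hnear (ε / (2 * (C + 1))) (by positivity)] with y hy1 hy2 hy3
  rw [lt_div_iff₀ hc0, mul_comm] at hy1 hy2
  -- the perturbed trajectory, solved backward from `y`
  obtain ⟨η, hη, hηeq⟩ := exists_eq_integral_dynamic_smul hkcont hkpos hkmax hklip' hu ht0 y
  have hηt : η t = y := by rw [hηeq t ht0]; simp
  have hηint : ∀ a b, 0 ≤ a → a ≤ b →
      IntervalIntegrable (fun s => k s (η s) • u s) volume a b := fun a b ha hab =>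
    (intervalIntegrable_iff_integrableOn_Icc_of_le hab).2 <|
      IntegrableOn.of_bound (C := kmax) measure_Icc_lt_top
        (aestronglyMeasurable_dynamic_smul hkcont hu.1 ha hη.aestronglyMeasurable) (by
          filter_upwards [ae_restrict_mem measurableSet_Icc] with s hs
          exact norm_dynamic_smul_le hkpos hkmax hu (ha.trans hs.1) _)
  have hηeq' : ∀ s ∈ Icc t₀ t, η s = η t₀ + ∫ r in t₀..s, k r (η r) • u r := by
    intro s hs
    rw [hηeq s (ht₀.trans hs.1), hηeq t₀ ht₀, add_assoc,
      intervalIntegral.integral_add_adjacent_intervals (hηint t₀ t ht₀ htt).symm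
        (hηint t₀ s ht₀ hs.1)]
  have hγi : ∀ s, t₀ ≤ s → IntervalIntegrable (fun s => k s (γ s) • u s) volume t₀ s :=
    fun s hs => hγ.intervalIntegrable hkcont hkpos hkmax ht₀ hu hs
  set z : ℝ → Evec d := fun s => η s - γ s with hz
  have hzint : IntervalIntegrable (fun s => k s (η s) • u s - k s (γ s) • u s) volume t₀ t :=
    (hηint t₀ t ht₀ htt).sub (hγi t htt)
  have hzeq : ∀ s ∈ Icc t₀ t,
      z s = z t₀ + ∫ r in t₀..s, (k r (η r) • u r - k r (γ r) • u r) := by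
    intro s hs
    simp only [hz]
    rw [intervalIntegral.integral_sub (hηint t₀ s ht₀ hs.1) (hγi s hs.1), hηeq' s hs, hγ s hs.1,
      hγ.apply_start]
    abel
  have hzbound : ∀ r ∈ Icc t₀ t, ‖k r (η r) • u r - k r (γ r) • u r‖ ≤ L * ‖z r‖ := by
    intro r hr
    rw [← sub_smul, norm_smul, Real.norm_eq_abs]
    exact (mul_le_of_le_one_right (abs_nonneg _) (hu.2 r)).trans
      (hklip' r (ht₀.trans hr.1) _ _)
  have hzle : ∀ r ∈ Icc t₀ t, ‖z r‖ ≤ c * ‖y - γ t‖ := by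
    have := norm_le_exp_mul_norm_right htt hL0 hzint hzeq hzbound
    simpa only [hz, hηt] using this
  have hηmem : ∀ r ∈ Icc t₀ t, η r ∈ interior Ω := fun r hr =>
    htube r hr _ ((hzle r hr).trans_lt hy1)
  -- the pairing with the adjoint arc varies quadratically
  have hpair : |⟪p t, z t⟫ - ⟪p t₀, z t₀⟫| ≤ C * ‖y - γ t‖ ^ 2 := by
    have := abs_inner_sub_inner_le (P := p) (Z := z) (A := L * N) (B := L * (c * ‖y - γ t‖))
      (C := N * (M * c ^ 2) * ‖y - γ t‖ ^ 2) htt hpint hzint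
      (fun r hr => (hpbound r hr).trans (mul_le_mul_of_nonneg_left (hN r hr) hL0))
      (fun r hr => (hzbound r hr).trans (mul_le_mul_of_nonneg_left (hzle r hr) hL0))
      hpeq hzeq (fun r hr => ?_)
    · refine this.trans (le_of_eq ?_)
      rw [hC]; ring
    · have hr0 : 0 ≤ r := ht₀.trans hr.1
      have hball : ∀ x ∈ closedBall (γ r) ‖η r - γ r‖, x ∈ Ω := fun x hx =>
        interior_subset (htube r hr x (by
          rw [mem_closedBall, dist_eq_norm] at hx
          exact (hx.trans (hzle r hr)).trans_lt hy1))
      have htaylor := abs_sub_sub_inner_gradient_le (f := fun x => k r x) (f' := gradk r)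
        (x := γ r) (y := η r) hM0 (fun x hx => hkgrad r hr0 x (hball x hx))
        (fun x hx => (hkgradlip r hr0 x (hball x hx) _ (hγΩ r hr)).trans
          (mul_le_mul_of_nonneg_right (le_abs_self _) (norm_nonneg _)))
      have e : ⟪p r, k r (η r) • u r - k r (γ r) • u r⟫ + ⟪-(⟪u r, p r⟫ • gradk r (γ r)), z r⟫
          = ⟪u r, p r⟫ * (k r (η r) - k r (γ r) - ⟪gradk r (γ r), η r - γ r⟫) := by
        rw [← sub_smul, real_inner_smul_right, inner_neg_left, real_inner_smul_left,
          real_inner_comm (u r) (p r)]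
        ring
      rw [e, abs_mul]
      calc |⟪u r, p r⟫| * |k r (η r) - k r (γ r) - ⟪gradk r (γ r), η r - γ r⟫|
          ≤ N * (M * (c * ‖y - γ t‖) ^ 2) := by
            refine mul_le_mul ((hup r).trans (hN r hr)) (htaylor.trans ?_) (abs_nonneg _) hN0
            have := hzle r hr
            simp only [hz] at this
            gcongr
        _ = _ := by ring
  -- dynamic programming
  have hdpp1 : valueFun Ω k g t₀ (η t₀) - (t - t₀) ≤ valueFun Ω k g t y := by
    refine le_csInf (costSet_nonempty hΩcomp ⟨_, hexit.1.2⟩ hkcont hkmin hkbdd hklip' ht0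
      (hηt ▸ interior_subset (hηmem t ⟨htt, le_rfl⟩))) fun b hb => ?_
    have := csInf_le (bddBelow_costSet hkcont hkpos hkmax hg0 ht₀ (η t₀))
      (add_mem_costSet hkcont hkpos hkmax ht₀ htt hu (hηint t₀ t ht₀ htt) hηeq'
        (fun s hs hfr => hfr.2 (hηmem s ⟨hs.1, hs.2.le⟩)) (hηt.symm ▸ hb))
    rw [valueFun]
    linarith
  have hdpp2 : valueFun Ω k g t (γ t) ≤ valueFun Ω k g t₀ x₀ - (t - t₀) := by
    have h0 : valueFun Ω k g t₀ x₀ = exitCost Ω g t₀ γ := hleast.csInf_eq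
    rw [h0]
    exact csInf_le (bddBelow_costSet hkcont hkpos hkmax hg0 ht0 _)
      (exitCost_sub_mem_costSet hkcont hkpos hkmax ht₀ hu hγ hne ⟨htt, ht.2.le⟩)
  have hzt₀ : ‖η t₀ - x₀‖ ≤ c * ‖y - γ t‖ := by
    have := hzle t₀ ⟨le_rfl, htt⟩
    simpa only [hz, hγ.apply_start] using this
  have hsub := hρball (y := η t₀) (by rw [dist_eq_norm]; exact hzt₀.trans_lt hy2)
  have hε1 : ε / (2 * c) * ‖η t₀ - x₀‖ ≤ ε / 2 * ‖y - γ t‖ := by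
    calc ε / (2 * c) * ‖η t₀ - x₀‖ ≤ ε / (2 * c) * (c * ‖y - γ t‖) := by gcongr
      _ = _ := by field_simp
  have hε2 : C * ‖y - γ t‖ ^ 2 ≤ ε / 2 * ‖y - γ t‖ := by
    rw [lt_div_iff₀ (by positivity)] at hy3
    have := norm_nonneg (y - γ t)
    nlinarith
  have hpair' := (abs_le.1 hpair).2
  simp only [hz, hηt, hγ.apply_start] at hpair'
  linarith
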